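/- arXiv:1612.02671 — 2 statements merged into one kernel-verified Lean document; each statement's English description precedes it below -/
import Mathlib

section
/- Let d be a decoration of [n] such that ε_{d(i)d(j)} = 0 for all i ≠ j in [n]. Then a d-decorated partition of [n] is ε-noncrossing if and only if its underlying partition is noncrossing. -/
/-!
Common setup: ε-noncrossing partitions (Ebrahimi-Fard–Patras–Speicher).

A partition of `[n]` is encoded as a `Setoid (Fin n)` (blocks = equivalence
classes).  A decoration is a map `d : Fin n → I`, and `ε : I → I → Bool` is a
symmetric family of values in `{0,1}` (with `true` playing the role of `1`).
-/

namespace EpsNC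

open scoped Classical

variable {I : Type*}

/-- The partition `σ(Γ)`: blocks are the images under `σ` of the blocks of `Γ`. -/
def permSetoid {n : ℕ} (σ : Equiv.Perm (Fin n)) (Γ : Setoid (Fin n)) : Setoid (Fin n) :=
  Setoid.comap (⇑σ⁻¹) Γ

/-- The decoration `σ(d)`, `σ(d)(i) = d(σ⁻¹(i))`. -/
def permDec {n : ℕ} (σ : Equiv.Perm (Fin n)) (d : Fin n → I) : Fin n → I :=
  d ∘ ⇑σ⁻¹

/-- The adjacent transposition `(i, j)` with `j = i + 1` is an allowed move for the
`d`-decorated partition `Γ` if `ε_{d(i)d(j)} = 1` and either `d(i) ≠ d(j)`, or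
`d(i) = d(j)` and `i`, `j` lie in different blocks of `Γ`. -/
def IsAllowedMove {n : ℕ} (ε : I → I → Bool) (d : Fin n → I) (Γ : Setoid (Fin n))
    (i j : Fin n) : Prop :=
  (i : ℕ) + 1 = (j : ℕ) ∧ ε (d i) (d j) = true ∧ (d i ≠ d j ∨ ¬ Γ i j)

/-- `σ` is an allowed permutation of the `d`-decorated partition `Γ` if it is a product
`τ_{i_k} ⋯ τ_{i_1}` of adjacent transpositions, each being an allowed move for the
(decorated) partition obtained by applying the previous ones. -/
inductive AllowedPerm {n : ℕ} (ε : I → I → Bool) (d : Fin n → I) (Γ : Setoid (Fin n)) :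
    Equiv.Perm (Fin n) → Prop
  | one : AllowedPerm ε d Γ 1
  | step {σ : Equiv.Perm (Fin n)} (i j : Fin n) :
      AllowedPerm ε d Γ σ →
      IsAllowedMove ε (permDec σ d) (permSetoid σ Γ) i j →
      AllowedPerm ε d Γ (Equiv.swap i j * σ)

/-- Standardization of the restriction of a map on `Fin n` to a subset `S`,
via the unique order isomorphism `Fin S.card ≃o S`. -/
noncomputable def restrictFun {n : ℕ} {α : Type*} (f : Fin n → α) (S : Finset (Fin n)) :
    Fin S.card → α :=
  fun k => f (S.orderIsoOfFin rfl k).1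

/-- Standardization of the restriction of a partition of `Fin n` to a subset `S`,
via the unique order isomorphism `Fin S.card ≃o S` (blocks are the nonempty
intersections of blocks with `S`, transported to `Fin S.card`). -/
noncomputable def restrictSetoid {n : ℕ} (Γ : Setoid (Fin n)) (S : Finset (Fin n)) :
    Setoid (Fin S.card) :=
  Setoid.comap (fun k => (S.orderIsoOfFin rfl k).1) Γ

/-- The block of the partition `Γ` containing `b`. -/
noncomputable def blockOf {n : ℕ} (Γ : Setoid (Fin n)) (b : Fin n) : Finset (Fin n) :=
  Finset.univ.filter (fun x => Γ b x)

/-- A subset of `Fin n` is an interval of consecutive integers iff it is order-connected. -/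
def IsIntervalBlock {n : ℕ} (S : Finset (Fin n)) : Prop :=
  ∀ ⦃x y z : Fin n⦄, x ∈ S → z ∈ S → x ≤ y → y ≤ z → y ∈ S

/-- A `d`-decorated partition `Γ` of `[n]` is ε-noncrossing if it can be reduced to the
empty partition by a finite sequence of reductions: a reduction consists of an allowed
permutation `σ` of `Γ` together with a block of `σ(Γ)` which is an interval of
consecutive integers; it deletes that block and standardizes the result. -/
inductive IsEpsNC (ε : I → I → Bool) : {n : ℕ} → (Fin n → I) → Setoid (Fin n) → Prop
  | empty (d : Fin 0 → I) (Γ : Setoid (Fin 0)) : IsEpsNC ε d Γ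
  | reduce {n : ℕ} {d : Fin n → I} {Γ : Setoid (Fin n)}
      (σ : Equiv.Perm (Fin n)) (b : Fin n)
      (hσ : AllowedPerm ε d Γ σ)
      (hint : IsIntervalBlock (blockOf (permSetoid σ Γ) b))
      (hrec : IsEpsNC ε
        (restrictFun (permDec σ d) (blockOf (permSetoid σ Γ) b)ᶜ)
        (restrictSetoid (permSetoid σ Γ) (blockOf (permSetoid σ Γ) b)ᶜ)) :
      IsEpsNC ε d Γ

/-- A partition of `[n]` is noncrossing if there are no `i < j < k < l` with `i, k` in
one block and `j, l` in a different block. -/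
def IsNoncrossing {n : ℕ} (Γ : Setoid (Fin n)) : Prop :=
  ∀ ⦃i j k l : Fin n⦄, i < j → j < k → k < l → Γ i k → Γ j l → Γ i j

/-- The set of blocks of a partition, as finsets. -/
noncomputable def blocksSet {n : ℕ} (Γ : Setoid (Fin n)) : Set (Finset (Fin n)) :=
  {B | ∃ b : Fin n, B = blockOf Γ b}

/-- `k_ε^Γ(a₁, …, aₙ)`: the product over the blocks `Γ_j = {x₁ < … < x_m}` of `Γ` of the
cumulants `κ(a_{x₁}, …, a_{x_m})` (with the corresponding decorations). -/
noncomputable def cumPart {K A : Type*} [Field K] {n : ℕ}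
    (κ : (m : ℕ) → (Fin m → I) → (Fin m → A) → K)
    (d : Fin n → I) (Γ : Setoid (Fin n)) (a : Fin n → A) : K :=
  ∏ᶠ B ∈ blocksSet Γ, κ B.card (restrictFun d B) (restrictFun a B)

/-- `φ^Γ(a₁, …, aₙ)`: the product over the blocks `Γ_j = {x₁ < … < x_m}` of `Γ` of the
moments `φ(a_{x₁} ⋯ a_{x_m})`. -/
noncomputable def phiPart {K A : Type*} [Field K] [Ring A] [Algebra K A] {n : ℕ}
    (φ : A →ₗ[K] K) (Γ : Setoid (Fin n)) (a : Fin n → A) : K :=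
  ∏ᶠ B ∈ blocksSet Γ, φ (List.ofFn (restrictFun a B)).prod

/-- The set of setoids on a finite type is finite (needed so that the sums over sets of
ε-noncrossing partitions below, taken with `∑ᶠ`, are honest finite sums). -/
instance {n : ℕ} : Finite (Setoid (Fin n)) :=
  Finite.of_injective (fun Γ : Setoid (Fin n) => ⇑Γ)
    (fun _ _ h => Setoid.ext fun x y => iff_of_eq (congrFun (congrFun h x) y))

/-- `κ` is the family of ε-cumulants of the noncommutative probability space `(A, φ)`
with distinguished subalgebras `(As i)_{i ∈ I}`: for every `n`, every decoration
`d : Fin n → I` and every tuple `a` with `a j ∈ As (d j)`, the moment-cumulant relation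
`φ(a₁ ⋯ aₙ) = Σ_{Γ ∈ P^{d,ε}_n} k_ε^Γ(a)` holds.  (This relation determines `κ`
uniquely on such tuples.) -/
def CumulantFamily {K A : Type*} [Field K] [Ring A] [Algebra K A]
    (ε : I → I → Bool) (φ : A →ₗ[K] K) (As : I → Subalgebra K A)
    (κ : (m : ℕ) → (Fin m → I) → (Fin m → A) → K) : Prop :=
  ∀ (m : ℕ) (d : Fin m → I) (a : Fin m → A), (∀ j, a j ∈ As (d j)) →
    φ (List.ofFn a).prod = ∑ᶠ Γ ∈ {Γ : Setoid (Fin m) | IsEpsNC ε d Γ}, cumPart κ d Γ a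

/-- The tuple `d = (d 1, …, d n)` lies in `I_n^ε`: whenever `d k = d l` for `k < l`,
there is `k < p < l` with `d p ≠ d k` and `ε_{d(p)d(k)} = 0`. -/
def MemIeps {n : ℕ} (ε : I → I → Bool) (d : Fin n → I) : Prop :=
  ∀ k l : Fin n, k < l → d k = d l →
    ∃ p : Fin n, k < p ∧ p < l ∧ d p ≠ d k ∧ ε (d p) (d k) = false

/-- The subalgebras `(As i)_{i ∈ I}` are ε-independent in `(A, φ)`. -/
def EpsIndependent {K A : Type*} [Field K] [Ring A] [Algebra K A]
    (ε : I → I → Bool) (φ : A →ₗ[K] K) (As : I → Subalgebra K A) : Prop :=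
  (∀ i j : I, i ≠ j → ε i j = true →
    ∀ a ∈ As i, ∀ b ∈ As j, a * b = b * a) ∧
  (∀ (n : ℕ) (d : Fin n → I) (a : Fin n → A), MemIeps ε d →
    (∀ k, a k ∈ As (d k)) → (∀ k, φ (a k) = 0) → φ (List.ofFn a).prod = 0)

/-- The join of two partitions in the lattice `P^{d,ε}_n` of ε-noncrossing partitions:
the finest ε-noncrossing partition coarser than both (computed as the meet, in the full
partition lattice, of all ε-noncrossing upper bounds). -/
noncomputable def epsJoin {n : ℕ} (ε : I → I → Bool) (d : Fin n → I)
    (Φ Ψ : Setoid (Fin n)) : Setoid (Fin n) :=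
  sInf {Θ : Setoid (Fin n) | IsEpsNC ε d Θ ∧ Φ ≤ Θ ∧ Ψ ≤ Θ}

theorem AllowedPerm.eq_one {I : Type*} {ε : I → I → Bool} {n : ℕ} {d : Fin n → I}
    (hd : ∀ i j : Fin n, i ≠ j → ε (d i) (d j) = false) {Γ : Setoid (Fin n)}
    {σ : Equiv.Perm (Fin n)} (h : AllowedPerm ε d Γ σ) : σ = 1 := by
  induction h with
  | one => rfl
  | @step σ i j _ hmove _ =>
    obtain ⟨hij, hε, -⟩ := hmove
    have hne : i ≠ j := by rintro rfl; omega
    have := hd (σ⁻¹ i) (σ⁻¹ j) (σ⁻¹.injective.ne hne)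
    simp_all [permDec]

theorem mem_blockOf {n : ℕ} {Γ : Setoid (Fin n)} {b x : Fin n} : x ∈ blockOf Γ b ↔ Γ b x := by
  simp [blockOf]

theorem card_compl_blockOf_lt {n : ℕ} (Γ : Setoid (Fin n)) (b : Fin n) :
    (blockOf Γ b)ᶜ.card < n := by
  have h : (blockOf Γ b)ᶜ ⊂ Finset.univ :=
    Finset.ssubset_univ_iff.2 fun h => by
      have : b ∈ (blockOf Γ b)ᶜ := h ▸ Finset.mem_univ b
      exact Finset.mem_compl.1 this (mem_blockOf.2 (Γ.refl b))
  simpa using Finset.card_lt_card h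

theorem restrictFun_pairwise_zero {I : Type*} {ε : I → I → Bool} {n : ℕ} {d : Fin n → I}
    (hd : ∀ i j : Fin n, i ≠ j → ε (d i) (d j) = false) (S : Finset (Fin n)) :
    ∀ i j, i ≠ j → ε (restrictFun d S i) (restrictFun d S j) = false := fun _ _ hij =>
  hd _ _ fun h => hij ((S.orderIsoOfFin rfl).injective (Subtype.ext h))

theorem IsNoncrossing.restrictSetoid {n : ℕ} {Γ : Setoid (Fin n)} (h : IsNoncrossing Γ)
    (S : Finset (Fin n)) : IsNoncrossing (restrictSetoid Γ S) := fun _ _ _ _ hij hjk hkl hik hjl =>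
  h ((S.orderIsoOfFin rfl).strictMono hij) ((S.orderIsoOfFin rfl).strictMono hjk)
    ((S.orderIsoOfFin rfl).strictMono hkl) hik hjl

theorem isNoncrossing_of_restrictSetoid_compl {n : ℕ} {Γ : Setoid (Fin n)} {b : Fin n}
    (hint : IsIntervalBlock (blockOf Γ b))
    (h : IsNoncrossing (restrictSetoid Γ (blockOf Γ b)ᶜ)) : IsNoncrossing Γ := by
  intro i j k l hij hjk hkl hik hjl
  by_cases hi : Γ b i
  · have hj := hint (mem_blockOf.2 hi) (mem_blockOf.2 (Γ.trans hi hik)) hij.le hjk.le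
    exact Γ.trans (Γ.symm hi) (mem_blockOf.1 hj)
  by_cases hj : Γ b j
  · have hk := hint (mem_blockOf.2 hj) (mem_blockOf.2 (Γ.trans hj hjl)) hjk.le hkl.le
    exact absurd (Γ.trans (mem_blockOf.1 hk) (Γ.symm hik)) hi
  have hk : ¬ Γ b k := fun hk => hi (Γ.trans hk (Γ.symm hik))
  have hl : ¬ Γ b l := fun hl => hj (Γ.trans hl (Γ.symm hjl))
  have lift : ∀ x, ¬ Γ b x → ∃ y, ((blockOf Γ b)ᶜ.orderIsoOfFin rfl y).1 = x := fun x hx => by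
    obtain ⟨y, hy⟩ := ((blockOf Γ b)ᶜ.orderIsoOfFin rfl).surjective
      ⟨x, Finset.mem_compl.2 fun hm => hx (mem_blockOf.1 hm)⟩
    exact ⟨y, congrArg Subtype.val hy⟩
  obtain ⟨i, rfl⟩ := lift i hi
  obtain ⟨j, rfl⟩ := lift j hj
  obtain ⟨k, rfl⟩ := lift k hk
  obtain ⟨l, rfl⟩ := lift l hl
  simp only [Subtype.coe_lt_coe, OrderIso.lt_iff_lt] at hij hjk hkl
  exact h hij hjk hkl hik hjl

/-- In a noncrossing partition, the block whose minimum is largest is an interval. -/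
theorem IsNoncrossing.exists_isIntervalBlock {n : ℕ} [NeZero n] {Γ : Setoid (Fin n)}
    (h : IsNoncrossing Γ) : ∃ b, IsIntervalBlock (blockOf Γ b) := by
  have hne : (Finset.univ.filter fun m : Fin n => ∀ w, Γ m w → m ≤ w).Nonempty :=
    ⟨0, by simp⟩
  obtain ⟨m, hm, hmax⟩ := Finset.exists_max_image _ id hne
  simp only [Finset.mem_filter, Finset.mem_univ, true_and, id] at hm hmax
  refine ⟨m, fun x y z hx hz hxy hyz => ?_⟩
  rw [mem_blockOf] at hx hz ⊢
  by_contra hy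
  obtain ⟨w, hw, hwmin⟩ := Finset.exists_min_image (blockOf Γ y) id
    ⟨y, mem_blockOf.2 (Γ.refl y)⟩
  simp only [mem_blockOf, id] at hw hwmin
  have hmw : ¬ Γ w m := fun hc => hy (Γ.symm (Γ.trans hw hc))
  have hwm : w < m := lt_of_le_of_ne (hmax w fun v hv => hwmin v (Γ.trans hw hv))
    fun hc => hmw (hc ▸ Γ.refl w)
  have hmy : m < y := lt_of_le_of_ne ((hm x hx).trans hxy) fun hc => hy (hc ▸ Γ.refl m)
  have hyz' : y < z := lt_of_le_of_ne hyz fun hc => hy (hc ▸ hz)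
  exact hmw (h hwm hmy hyz' (Γ.symm hw) hz)

theorem IsEpsNC.isNoncrossing {I : Type*} {ε : I → I → Bool} {n : ℕ} {d : Fin n → I}
    {Γ : Setoid (Fin n)} (h : IsEpsNC ε d Γ)
    (hd : ∀ i j : Fin n, i ≠ j → ε (d i) (d j) = false) : IsNoncrossing Γ := by
  induction h with
  | empty => exact fun i => i.elim0
  | reduce σ b hσ hint _ ih =>
    obtain rfl := hσ.eq_one hd
    exact isNoncrossing_of_restrictSetoid_compl hint (ih (restrictFun_pairwise_zero hd _))

theorem IsNoncrossing.isEpsNC {I : Type*} (ε : I → I → Bool) {n : ℕ} (d : Fin n → I)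
    {Γ : Setoid (Fin n)} (h : IsNoncrossing Γ) : IsEpsNC ε d Γ := by
  induction n using Nat.strong_induction_on with
  | _ n ih =>
    obtain rfl | hn := eq_or_ne n 0
    · exact .empty d Γ
    have : NeZero n := ⟨hn⟩
    obtain ⟨b, hb⟩ := h.exists_isIntervalBlock
    exact .reduce 1 b .one hb (ih _ (card_compl_blockOf_lt Γ b) _ (h.restrictSetoid _))

/-- If `ε_{d(i)d(j)} = 0` for all `i ≠ j` in `[n]`, then a
`d`-decorated partition of `[n]` is ε-noncrossing if and only if its underlying
partition is noncrossing. -/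
theorem isEpsNC_iff_noncrossing_of_forall_zero {I : Type*} (ε : I → I → Bool)
    (hsym : ∀ i j : I, ε i j = ε j i)
    {n : ℕ} (d : Fin n → I) (hd : ∀ i j : Fin n, i ≠ j → ε (d i) (d j) = false)
    (Γ : Setoid (Fin n)) :
    IsEpsNC ε d Γ ↔ IsNoncrossing Γ :=
  ⟨fun h => h.isNoncrossing hd, fun h => h.isEpsNC ε d⟩

end EpsNC
end

section
/- Let Γ be a d-decorated ε-noncrossing partition of [n] and let X be an arbitrary subset of [n]. Then the standardization Γ_X of the restriction of Γ to X (with the standardization of the restricted decoration) is an ε-noncrossing decorated partition of [|X|]. -/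
/-!
Common setup: ε-noncrossing partitions (Ebrahimi-Fard–Patras–Speicher).

A partition of `[n]` is encoded as a `Setoid (Fin n)` (blocks = equivalence
classes).  A decoration is a map `d : Fin n → I`, and `ε : I → I → Bool` is a
symmetric family of values in `{0,1}` (with `true` playing the role of `1`).
-/

namespace EpsNC

open scoped Classical

variable {I : Type*}

theorem permSetoid_rel {n : ℕ} (σ : Equiv.Perm (Fin n)) (Γ : Setoid (Fin n)) (x y : Fin n) :
    permSetoid σ Γ x y ↔ Γ (σ⁻¹ x) (σ⁻¹ y) :=
  Iff.rfl

theorem restrictSetoid_rel {n : ℕ} (Γ : Setoid (Fin n)) (S : Finset (Fin n))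
    (x y : Fin S.card) :
    restrictSetoid Γ S x y ↔ Γ (S.orderIsoOfFin rfl x).1 (S.orderIsoOfFin rfl y).1 :=
  Iff.rfl

theorem permDec_mul {n : ℕ} (σ ρ : Equiv.Perm (Fin n)) (d : Fin n → I) :
    permDec σ (permDec ρ d) = permDec (σ * ρ) d := by
  simp [permDec, Function.comp_assoc, mul_inv_rev]

theorem permSetoid_mul {n : ℕ} (σ ρ : Equiv.Perm (Fin n)) (Γ : Setoid (Fin n)) :
    permSetoid σ (permSetoid ρ Γ) = permSetoid (σ * ρ) Γ := by
  ext x y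
  simp only [permSetoid_rel, mul_inv_rev, Equiv.Perm.mul_apply]

theorem AllowedPerm.mul {n : ℕ} {ε : I → I → Bool} {d : Fin n → I} {Γ : Setoid (Fin n)}
    {σ ρ : Equiv.Perm (Fin n)} (hρ : AllowedPerm ε d Γ ρ)
    (hσ : AllowedPerm ε (permDec ρ d) (permSetoid ρ Γ) σ) : AllowedPerm ε d Γ (σ * ρ) := by
  induction hσ with
  | one => simpa using hρ
  | step i j _ hmove ih =>
    rw [permDec_mul, permSetoid_mul] at hmove
    rw [mul_assoc]
    exact ih.step i j hmove

theorem IsEpsNC.of_allowedPerm {n : ℕ} {ε : I → I → Bool} {d : Fin n → I}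
    {Γ : Setoid (Fin n)} {ρ : Equiv.Perm (Fin n)} (hρ : AllowedPerm ε d Γ ρ)
    (h : IsEpsNC ε (permDec ρ d) (permSetoid ρ Γ)) : IsEpsNC ε d Γ := by
  generalize hd : permDec ρ d = d' at h
  generalize hΓ : permSetoid ρ Γ = Γ' at h
  cases h with
  | empty => exact .empty d Γ
  | reduce σ b hσ hint hrec =>
    subst hd hΓ
    have hσρ := hρ.mul hσ
    rw [permSetoid_mul] at hint hrec
    rw [permDec_mul] at hrec
    exact .reduce (σ * ρ) b hσρ hint hrec

/-- Restricting an allowed permutation `σ` along an order embedding `e` gives an allowed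
permutation `ρ` of the pullback, up to moving the embedding to `e'`. -/
theorem AllowedPerm.exists_pullback {m n : ℕ} {ε : I → I → Bool} {d : Fin n → I}
    {Γ : Setoid (Fin n)} {σ : Equiv.Perm (Fin n)} (hσ : AllowedPerm ε d Γ σ)
    (e : Fin m ↪o Fin n) :
    ∃ (ρ : Equiv.Perm (Fin m)) (e' : Fin m ↪o Fin n),
      AllowedPerm ε (d ∘ e) (Γ.comap e) ρ ∧
      permDec ρ (d ∘ e) = permDec σ d ∘ e' ∧
      permSetoid ρ (Γ.comap e) = (permSetoid σ Γ).comap e' := by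
  suffices h : ∃ (ρ : Equiv.Perm (Fin m)) (e' : Fin m ↪o Fin n),
      AllowedPerm ε (d ∘ e) (Γ.comap e) ρ ∧ ∀ k, e (ρ⁻¹ k) = σ⁻¹ (e' k) by
    obtain ⟨ρ, e', hρ, he⟩ := h
    refine ⟨ρ, e', hρ, ?_, ?_⟩
    · ext k
      simp only [permDec, Function.comp_apply, he]
    · ext x y
      simp only [permSetoid_rel, Setoid.comap_rel, he]
  induction hσ with
  | one => exact ⟨1, e, .one, fun k => by simp⟩
  | @step σ i j _ hmove ih =>
    obtain ⟨ρ, e', hρ, he⟩ := ih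
    obtain ⟨hij, hε, hne⟩ := hmove
    by_cases hmem : ∃ a b, e' a = i ∧ e' b = j
    · obtain ⟨a, b, rfl, rfl⟩ := hmem
      refine ⟨Equiv.swap a b * ρ, e', hρ.step a b ⟨?_, ?_, ?_⟩, fun k => ?_⟩
      · have hab : a < b := e'.lt_iff_lt.1 (Fin.lt_def.2 (by omega))
        by_contra hcon
        have hlt : (a : ℕ) + 1 < b := by have := Fin.lt_def.1 hab; omega
        let c : Fin m := ⟨a + 1, hlt.trans b.2⟩
        have hac : e' a < e' c := e'.lt_iff_lt.2 (Fin.lt_def.2 (Nat.lt_succ_self _))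
        have hcb : e' c < e' b := e'.lt_iff_lt.2 (Fin.lt_def.2 hlt)
        rw [Fin.lt_def] at hac hcb
        omega
      · simpa only [permDec, Function.comp_apply, he] using hε
      · simpa only [permDec, Function.comp_apply, permSetoid_rel, Setoid.comap_rel, he] using hne
      · simp only [mul_inv_rev, Equiv.swap_inv, Equiv.Perm.mul_apply, he]
        rw [e'.injective.swap_apply]
    · refine ⟨ρ, OrderEmbedding.ofStrictMono (fun k => Equiv.swap i j (e' k)) ?_, hρ,
        fun k => by
          rw [OrderEmbedding.coe_ofStrictMono, mul_inv_rev, Equiv.swap_inv,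
            Equiv.Perm.mul_apply, Equiv.swap_apply_self, he]⟩
      intro x y hxy
      have hlt : e' x < e' y := e'.lt_iff_lt.2 hxy
      have hnot : ¬ (e' x = i ∧ e' y = j) := fun h => hmem ⟨x, y, h⟩
      simp only [Equiv.swap_apply_def]
      split_ifs <;> simp only [Fin.lt_def, Fin.ext_iff] at * <;> omega

theorem exists_orderEmbedding_card {m n : ℕ} (S : Finset (Fin n)) (f : Fin m ↪o Fin n)
    (hf : ∀ k, f k ∈ S) :
    ∃ g : Fin m ↪o Fin S.card, ∀ k, (S.orderIsoOfFin rfl (g k)).1 = f k := by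
  refine ⟨OrderEmbedding.ofStrictMono (fun k => (S.orderIsoOfFin rfl).symm ⟨f k, hf k⟩) ?_,
    fun k => by rw [OrderEmbedding.coe_ofStrictMono, OrderIso.apply_symm_apply]⟩
  intro x y hxy
  simpa using hxy

theorem IsEpsNC.comap {n : ℕ} {ε : I → I → Bool} {d : Fin n → I} {Γ : Setoid (Fin n)}
    (h : IsEpsNC ε d Γ) {m : ℕ} (e : Fin m ↪o Fin n) : IsEpsNC ε (d ∘ e) (Γ.comap e) := by
  induction h generalizing m with
  | empty d Γ =>
    obtain rfl : m = 0 := by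
      by_contra hm
      exact (e ⟨0, Nat.pos_of_ne_zero hm⟩).elim0
    exact .empty _ _
  | @reduce n d Γ σ b hσ hint _ ih =>
    obtain ⟨ρ, e', hρ, hd, hΓ⟩ := hσ.exists_pullback e
    have hrel : ∀ x y, permSetoid ρ (Γ.comap e) x y ↔ permSetoid σ Γ (e' x) (e' y) :=
      fun x y => by rw [hΓ, Setoid.comap_rel]
    have key : ∀ {l : ℕ} (f : Fin l ↪o Fin n), (∀ k, f k ∈ (blockOf (permSetoid σ Γ) b)ᶜ) →
        IsEpsNC ε (permDec σ d ∘ f) ((permSetoid σ Γ).comap f) := by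
      intro l f hf
      obtain ⟨g, hg⟩ := exists_orderEmbedding_card _ f hf
      convert ih g using 1
      · ext k
        simp only [Function.comp_apply, restrictFun, hg]
      · ext x y
        simp only [Setoid.comap_rel, restrictSetoid_rel, hg]
    by_cases hmeet : ∃ a, e' a ∈ blockOf (permSetoid σ Γ) b
    · obtain ⟨a, ha⟩ := hmeet
      have hmem : ∀ k, k ∈ blockOf (permSetoid ρ (Γ.comap e)) a ↔
          e' k ∈ blockOf (permSetoid σ Γ) b := by
        intro k
        simp only [blockOf, Finset.mem_filter, Finset.mem_univ, true_and, hrel] at ha ⊢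
        exact ⟨fun h => Setoid.trans' _ ha h,
          fun h => Setoid.trans' _ (Setoid.symm' _ ha) h⟩
      refine .reduce ρ a hρ (fun x y z hx hz hxy hyz => ?_) ?_
      · rw [hmem] at hx hz ⊢
        exact hint hx hz (e'.le_iff_le.2 hxy) (e'.le_iff_le.2 hyz)
      · have := key (((blockOf (permSetoid ρ (Γ.comap e)) a)ᶜ.orderEmbOfFin rfl).trans e')
          fun k => by
            have hk := Finset.orderEmbOfFin_mem
              (blockOf (permSetoid ρ (Γ.comap e)) a)ᶜ rfl k
            rw [Finset.mem_compl, hmem] at hk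
            exact Finset.mem_compl.2 hk
        convert this using 1
        · rw [hd]
          rfl
        · ext x y
          simp only [restrictSetoid_rel, Setoid.comap_rel, hrel]
          rfl
    · refine .of_allowedPerm hρ ?_
      rw [hd, hΓ]
      exact key e' fun k => Finset.mem_compl.2 fun hk => hmeet ⟨k, hk⟩

/-- If `Γ` is a `d`-decorated ε-noncrossing partition of `[n]` and
`X ⊆ [n]`, then the standardization `Γ_X` of the restriction of `Γ` to `X`, with the
standardization of the restricted decoration, is an ε-noncrossing decorated partition
of `[|X|]`. -/
theorem isEpsNC_restrict {I : Type*} (ε : I → I → Bool)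
    (hsym : ∀ i j : I, ε i j = ε j i)
    {n : ℕ} (d : Fin n → I) (Γ : Setoid (Fin n)) (hΓ : IsEpsNC ε d Γ)
    (X : Finset (Fin n)) :
    IsEpsNC ε (restrictFun d X) (restrictSetoid Γ X) :=
  hΓ.comap (X.orderEmbOfFin rfl)

end EpsNC
end
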